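/- arXiv:0706.4055 — 2 statements merged into one kernel-verified Lean document; each statement's English description precedes it below -/
import Mathlib

section
/- There exists a universal constant C > 0 with the following property. Let k, l ∈ ℤ with k ≤ 0 and l ≥ 0, let m ∈ ℝ with |m| ≤ 2^{l−k+3}, let σ ∈ {+1, −1}, let y, t ∈ ℝ with |t| ≤ 1, and let ξ ∈ ℝ with 2^{k−2} ≤ |ξ| ≤ 2^{k+2}. Then | ∫_ℝ μ₀(2^l(μ/ξ + σ√3ξ − m))² · e^{i(yμ + tμ²/ξ)} dμ | ≤ C · 2^{k−l} · (1 + 2^{k−l}|y|)^{−2}. -/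
open MeasureTheory Real Set

noncomputable section

/-- The oscillatory integral `∫ μ₀(2^l(μ/ξ + σ√3ξ − m))² e^{i(yμ + tμ²/ξ)} dμ`. -/
def oscIntAng (μ₀ : ℝ → ℝ) (l : ℤ) (m σ ξ y t : ℝ) : ℂ :=
  ∫ μ : ℝ, (((μ₀ ((2:ℝ) ^ l * (μ / ξ + σ * Real.sqrt 3 * ξ - m))) ^ 2 : ℝ) : ℂ) *
    Complex.exp (Complex.I * ((y * μ + t * μ ^ 2 / ξ : ℝ) : ℂ))

/-- The quadratic oscillating factor `e^{i(bs + cs²)}`. -/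
def quadPhase (b c s : ℝ) : ℂ :=
  Complex.exp (Complex.I * ((b * s + c * s ^ 2 : ℝ) : ℂ))

theorem norm_quadPhase (b c s : ℝ) : ‖quadPhase b c s‖ = 1 := by
  rw [quadPhase, mul_comm]
  exact Complex.norm_exp_ofReal_mul_I _

theorem hasDerivAt_quadPhase (b c s : ℝ) :
    HasDerivAt (quadPhase b c) (Complex.I * (b + 2 * c * s) * quadPhase b c s) s := by
  have h : HasDerivAt (fun s : ℝ => b * s + c * s ^ 2) (b + 2 * c * s) s := by
    have := ((hasDerivAt_id s).const_mul b).add (((hasDerivAt_id s).pow 2).const_mul c)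
    exact this.congr_deriv (by simp; ring)
  refine (h.ofReal_comp.const_mul Complex.I).cexp.congr_deriv ?_
  rw [quadPhase]
  push_cast
  ring

theorem continuous_quadPhase (b c : ℝ) : Continuous (quadPhase b c) :=
  continuous_iff_continuousAt.2 fun s => (hasDerivAt_quadPhase b c s).continuousAt

/-- Integration by parts against `e^{i(bs + cs²)}`. -/
theorem mul_integral_quadPhase (b c : ℝ) {u u' : ℝ → ℂ} (hu : ∀ s, HasDerivAt u (u' s) s)
    (hu' : Continuous u') (hsupp : HasCompactSupport u) (hsupp' : HasCompactSupport u') :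
    Complex.I * b * ∫ s, u s * quadPhase b c s =
      -∫ s, (u' s + 2 * Complex.I * c * s * u s) * quadPhase b c s := by
  have hq := continuous_quadPhase b c
  have hcu : Continuous u := continuous_iff_continuousAt.2 fun s => (hu s).continuousAt
  have hi : Integrable fun s => u s * quadPhase b c s :=
    (hcu.mul hq).integrable_of_hasCompactSupport hsupp.mul_right
  have hi' : Integrable fun s : ℝ => (u' s + 2 * Complex.I * c * s * u s) * quadPhase b c s := by
    refine Continuous.integrable_of_hasCompactSupport (by fun_prop) ?_
    exact (hsupp'.add hsupp.mul_left).mul_right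
  have hz := integral_eq_zero_of_hasDerivAt_of_integrable
    (fun s => (hu s).mul (hasDerivAt_quadPhase b c s)) (?_) hi
  · have heq : (fun s : ℝ => u' s * quadPhase b c s +
        u s * (Complex.I * (b + 2 * c * s) * quadPhase b c s)) =
        fun s : ℝ => (Complex.I * b) * (u s * quadPhase b c s) +
          (u' s + 2 * Complex.I * c * s * u s) * quadPhase b c s := by
      funext s; ring
    rw [heq, integral_add (hi.const_mul _) hi', integral_const_mul] at hz
    exact eq_neg_of_add_eq_zero_left hz
  · refine ((hi.const_mul (Complex.I * b)).add hi').congr (Filter.Eventually.of_forall fun s => ?_)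
    simp only [Pi.add_apply]
    ring

/-- Quadratic decay in the frequency `b`, uniformly for `|c|` bounded by a constant. -/
theorem exists_norm_integral_quadPhase_le {f f₁ f₂ : ℝ → ℝ} (hd0 : ∀ s, HasDerivAt f (f₁ s) s)
    (hd1 : ∀ s, HasDerivAt f₁ (f₂ s) s) (hc2 : Continuous f₂) (hsupp : HasCompactSupport f)
    (A : ℝ) :
    ∃ M : ℝ, 0 < M ∧ ∀ b c : ℝ, |c| ≤ A →
      (1 + b ^ 2) * ‖∫ s, (f s : ℂ) * quadPhase b c s‖ ≤ M := by
  have hc0 : Continuous f := continuous_iff_continuousAt.2 fun s => (hd0 s).continuousAt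
  have hc1 : Continuous f₁ := continuous_iff_continuousAt.2 fun s => (hd1 s).continuousAt
  have hs1 : HasCompactSupport f₁ := by
    have := hsupp.deriv
    rwa [show deriv f = f₁ from funext fun s => (hd0 s).deriv] at this
  have hs2 : HasCompactSupport f₂ := by
    have := hs1.deriv
    rwa [show deriv f₁ = f₂ from funext fun s => (hd1 s).deriv] at this
  set H : ℝ → ℝ := fun s => |f₂ s| + 4 * |A| * |s| * |f₁ s| +
    (1 + 2 * |A| + 4 * |A| ^ 2 * |s| ^ 2) * |f s| with hH
  have hH0 : ∀ s, 0 ≤ H s := fun s => by positivity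
  have hHi : Integrable H := by
    refine Continuous.integrable_of_hasCompactSupport (by fun_prop) ?_
    exact (hs2.norm.add hs1.norm.mul_left).add hsupp.norm.mul_left
  have hHint : 0 ≤ ∫ s, H s := integral_nonneg hH0
  have lift : ∀ {g : ℝ → ℝ}, HasCompactSupport g → HasCompactSupport fun s => (g s : ℂ) :=
    fun hg => hg.comp_left (g := ((↑) : ℝ → ℂ)) Complex.ofReal_zero
  refine ⟨2 * (∫ s, H s) + 1, by positivity, fun b c hc => ?_⟩
  have hcA : |c| ≤ |A| := hc.trans (le_abs_self A)
  have h0 : ‖∫ s, (f s : ℂ) * quadPhase b c s‖ ≤ ∫ s, H s := by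
    refine norm_integral_le_of_norm_le hHi (Filter.Eventually.of_forall fun s => ?_)
    rw [norm_mul, norm_quadPhase, mul_one, Complex.norm_real, Real.norm_eq_abs]
    have : 0 ≤ |f₂ s| + 4 * |A| * |s| * |f₁ s| +
      (2 * |A| + 4 * |A| ^ 2 * |s| ^ 2) * |f s| := by positivity
    simp only [hH]
    linarith
  have e1 := mul_integral_quadPhase b c (u := fun s => (f s : ℂ)) (u' := fun s => (f₁ s : ℂ))
    (fun s => (hd0 s).ofReal_comp) (by fun_prop)
    (lift hsupp) (lift hs1)
  have hu : ∀ s : ℝ, HasDerivAt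
      (fun s : ℝ => (f₁ s : ℂ) + 2 * Complex.I * c * s * f s)
      (f₂ s + (2 * Complex.I * c * f s + 2 * Complex.I * c * s * f₁ s)) s := by
    intro s
    have hid : HasDerivAt (fun s : ℝ => 2 * Complex.I * c * (s : ℂ)) (2 * Complex.I * c) s := by
      simpa using (hasDerivAt_id s).ofReal_comp.const_mul (2 * Complex.I * c)
    exact (hd1 s).ofReal_comp.add (hid.mul (hd0 s).ofReal_comp)
  have e2 := mul_integral_quadPhase b c hu (by fun_prop)
    ((lift hs1).add (lift hsupp).mul_left)
    ((lift hs2).add ((lift hsupp).mul_left.add (lift hs1).mul_left))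
  have h2 : b ^ 2 * ‖∫ s, (f s : ℂ) * quadPhase b c s‖ ≤ ∫ s, H s := by
    have e3 : b ^ 2 * ‖∫ s, (f s : ℂ) * quadPhase b c s‖ =
        ‖Complex.I * b * (Complex.I * b * ∫ s, (f s : ℂ) * quadPhase b c s)‖ := by
      simp only [norm_mul, Complex.norm_I, Complex.norm_real, Real.norm_eq_abs]
      rw [← sq_abs b]
      ring
    rw [e3, e1, mul_neg, e2, neg_neg]
    refine norm_integral_le_of_norm_le hHi (Filter.Eventually.of_forall fun s => ?_)
    rw [norm_mul, norm_quadPhase, mul_one]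
    have e4 : (f₂ s : ℂ) +
          (2 * Complex.I * c * f s + 2 * Complex.I * c * s * f₁ s) +
          2 * Complex.I * c * s * (f₁ s + 2 * Complex.I * c * s * f s) =
        f₂ s + 4 * Complex.I * c * s * f₁ s +
          (2 * Complex.I * c + 4 * (Complex.I * c * s) ^ 2) * f s := by ring
    rw [e4]
    have n1 : ‖4 * Complex.I * c * s * (f₁ s : ℂ)‖ = 4 * |c| * |s| * |f₁ s| := by
      simp
    have n2 : ‖(2 * Complex.I * c + 4 * (Complex.I * c * s) ^ 2) * (f s : ℂ)‖ ≤
        (2 * |c| + 4 * |c| ^ 2 * |s| ^ 2) * |f s| := by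
      rw [norm_mul, Complex.norm_real, Real.norm_eq_abs]
      gcongr
      refine (norm_add_le _ _).trans (le_of_eq ?_)
      simp only [norm_mul, norm_pow, Complex.norm_I, Complex.norm_real, Real.norm_eq_abs,
        Complex.norm_ofNat]
      ring
    have n0 : ‖(f₂ s : ℂ)‖ = |f₂ s| := by simp
    calc _ ≤ |f₂ s| + 4 * |c| * |s| * |f₁ s| +
          (2 * |c| + 4 * |c| ^ 2 * |s| ^ 2) * |f s| := by
            refine (norm_add₃_le).trans ?_
            rw [n0, n1]
            gcongr
      _ ≤ |f₂ s| + 4 * |A| * |s| * |f₁ s| +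
          (1 + 2 * |A| + 4 * |A| ^ 2 * |s| ^ 2) * |f s| := by
            gcongr
            linarith
  linarith

theorem integral_eq_abs_mul_integral_comp_affine (g : ℝ → ℂ) {r : ℝ} (hr : r ≠ 0) (d : ℝ) :
    ∫ x, g x = ((|r| : ℝ) : ℂ) * ∫ s, g (r * s + d) := by
  have h := Measure.integral_comp_mul_left (fun x => g (x + d)) r
  rw [h, integral_add_right_eq_self, Complex.real_smul, ← mul_assoc, ← Complex.ofReal_mul,
    ← abs_mul, mul_inv_cancel₀ hr]
  simp

/-- Rescaling so that the cutoff becomes `μ₀(s)²` and the phase becomes quadratic in `s`. -/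
theorem norm_oscIntAng (μ₀ : ℝ → ℝ) (l : ℤ) (m σ y t : ℝ) {ξ : ℝ} (hξ : ξ ≠ 0) :
    ‖oscIntAng μ₀ l m σ ξ y t‖ = |ξ| / 2 ^ l *
      ‖∫ s, ((μ₀ s ^ 2 : ℝ) : ℂ) * quadPhase (ξ / 2 ^ l * (y + 2 * t * (m - σ * √3 * ξ)))
        (t * ξ / (2 ^ l) ^ 2) s‖ := by
  rw [oscIntAng]
  have hL : (0:ℝ) < 2 ^ l := by positivity
  set L : ℝ := 2 ^ l
  set a : ℝ := m - σ * √3 * ξ with ha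
  rw [integral_eq_abs_mul_integral_comp_affine _ (div_ne_zero hξ hL.ne') (ξ * a)]
  have key : ∀ s : ℝ,
      (((μ₀ (L * ((ξ / L * s + ξ * a) / ξ + σ * √3 * ξ - m))) ^ 2 : ℝ) : ℂ) *
        Complex.exp (Complex.I *
          ((y * (ξ / L * s + ξ * a) + t * (ξ / L * s + ξ * a) ^ 2 / ξ : ℝ) : ℂ)) =
      Complex.exp (((y * ξ * a + t * ξ * a ^ 2 : ℝ) : ℂ) * Complex.I) *
        (((μ₀ s ^ 2 : ℝ) : ℂ) * quadPhase (ξ / L * (y + 2 * t * a)) (t * ξ / L ^ 2) s) := by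
    intro s
    have h1 : L * ((ξ / L * s + ξ * a) / ξ + σ * √3 * ξ - m) = s := by
      rw [ha]; field_simp; ring
    have h2 : y * (ξ / L * s + ξ * a) + t * (ξ / L * s + ξ * a) ^ 2 / ξ =
        (y * ξ * a + t * ξ * a ^ 2) +
          (ξ / L * (y + 2 * t * a) * s + t * ξ / L ^ 2 * s ^ 2) := by
      field_simp; ring
    rw [h1, h2, quadPhase, Complex.ofReal_add, mul_add, Complex.exp_add,
      mul_comm Complex.I ((y * ξ * a + t * ξ * a ^ 2 : ℝ) : ℂ)]
    ring
  simp_rw [key]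
  rw [integral_const_mul, norm_mul, norm_mul, Complex.norm_exp_ofReal_mul_I, one_mul,
    Complex.norm_real, norm_abs_eq_norm, Real.norm_eq_abs, abs_div, abs_of_pos hL]

/-- The rescaled linear frequency controls `v/L·|y|` up to a bounded error. -/
theorem abs_le_abs_rescaled_frequency {v L ξ m σ t : ℝ} (y : ℝ) (hv : 0 < v) (hv1 : v ≤ 1)
    (hL : 1 ≤ L) (hm : |m| ≤ 8 * (L / v)) (hσ : |σ| = 1) (ht : |t| ≤ 1)
    (hξ : v / 4 ≤ |ξ|) (hξ' : |ξ| ≤ 4 * v) :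
    v / L * |y| ≤ 4 * |ξ / L * (y + 2 * t * (m - σ * √3 * ξ))| + 512 := by
  have hL0 : 0 < L := by linarith
  have h3 : √3 ≤ 2 := Real.sqrt_le_iff.2 (by norm_num)
  have hvL : v / L ≤ 1 := (div_le_one hL0).2 (hv1.trans hL)
  have ha : |m - σ * √3 * ξ| ≤ 8 * (L / v) + 8 := by
    refine (abs_sub _ _).trans ?_
    rw [abs_mul, abs_mul, hσ, one_mul, abs_of_nonneg (Real.sqrt_nonneg 3)]
    nlinarith [abs_nonneg ξ, Real.sqrt_nonneg 3]
  have hr : |ξ / L| ≤ 4 * (v / L) := by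
    rw [abs_div, abs_of_pos hL0, ← mul_div_assoc]
    gcongr
  have hr' : v / L ≤ 4 * |ξ / L| := by
    rw [abs_div, abs_of_pos hL0, ← mul_div_assoc]
    gcongr
    linarith
  have herr : |ξ / L * (2 * t * (m - σ * √3 * ξ))| ≤ 128 := by
    rw [abs_mul, abs_mul, abs_mul, abs_two]
    calc |ξ / L| * (2 * |t| * |m - σ * √3 * ξ|)
        ≤ 4 * (v / L) * (2 * 1 * (8 * (L / v) + 8)) := by gcongr
      _ = 64 + 64 * (v / L) := by field_simp; ring
      _ ≤ 128 := by linarith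
  have htri : |ξ / L| * |y| ≤ |ξ / L * (y + 2 * t * (m - σ * √3 * ξ))| + 128 := by
    rw [← abs_mul]
    calc |ξ / L * y| = |ξ / L * (y + 2 * t * (m - σ * √3 * ξ)) -
          ξ / L * (2 * t * (m - σ * √3 * ξ))| := by congr 1; ring
      _ ≤ _ := (abs_sub _ _).trans (by linarith)
  nlinarith [mul_le_mul_of_nonneg_right hr' (abs_nonneg y)]

theorem oscillatory_integral_decay_angular_low_freq (μ₀ : ℝ → ℝ)
    (hsmooth : ContDiff ℝ (⊤ : ℕ∞) μ₀) (hrange : ∀ s, μ₀ s ∈ Icc (0:ℝ) 1)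
    (hsupp : Function.support μ₀ ⊆ Icc (-8/5 : ℝ) (8/5))
    (hone : ∀ s ∈ Icc (-5/4 : ℝ) (5/4 : ℝ), μ₀ s = 1)
    (heven : ∀ s, μ₀ (-s) = μ₀ s) :
    ∃ C : ℝ, 0 < C ∧ ∀ k l : ℤ, k ≤ 0 → 0 ≤ l →
      ∀ m σ : ℝ, |m| ≤ (2:ℝ) ^ (l - k + 3) → (σ = 1 ∨ σ = -1) →
      ∀ y t ξ : ℝ, |t| ≤ 1 → (2:ℝ) ^ (k - 2) ≤ |ξ| → |ξ| ≤ (2:ℝ) ^ (k + 2) →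
      ‖oscIntAng μ₀ l m σ ξ y t‖ ≤
        C * (2:ℝ) ^ (k - l) * (1 + (2:ℝ) ^ (k - l) * |y|) ^ (-2 : ℝ) := by
  have hcs : HasCompactSupport fun s => μ₀ s ^ 2 := by
    refine HasCompactSupport.of_support_subset_isCompact (K := Icc (-8/5 : ℝ) (8/5))
      isCompact_Icc fun s hs => hsupp ?_
    simpa using hs
  have hcd : ContDiff ℝ 2 fun s => μ₀ s ^ 2 :=
    (hsmooth.of_le (WithTop.coe_le_coe.2 le_top)).pow 2
  have hcd1 : ContDiff ℝ 1 (deriv fun s => μ₀ s ^ 2) := by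
    rw [show (2 : WithTop ℕ∞) = 1 + 1 by norm_num, contDiff_succ_iff_deriv] at hcd
    exact hcd.2.2
  obtain ⟨M, hM, hdecay⟩ := exists_norm_integral_quadPhase_le
    (fun s => (hcd.differentiable (by norm_num) s).hasDerivAt)
    (fun s => (hcd1.differentiable (by norm_num) s).hasDerivAt)
    (hcd1.continuous_deriv le_rfl) hcs 4
  refine ⟨4 * (2 * 513 ^ 2 * M), by positivity, ?_⟩
  intro k l hk hl m σ hm hσ y t ξ ht hξ hξ'
  have hv : (0:ℝ) < 2 ^ k := by positivity
  have hv1 : (2:ℝ) ^ k ≤ 1 := zpow_le_one_of_nonpos₀ one_le_two hk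
  have hL : (1:ℝ) ≤ 2 ^ l := one_le_zpow₀ one_le_two hl
  rw [zpow_add₀ two_ne_zero, zpow_sub₀ two_ne_zero] at hm
  rw [zpow_sub₀ two_ne_zero] at hξ
  rw [zpow_add₀ two_ne_zero] at hξ'
  rw [zpow_sub₀ two_ne_zero, Real.rpow_neg (by positivity), Real.rpow_two]
  set v : ℝ := 2 ^ k
  set L : ℝ := 2 ^ l with hLdef
  have hL0 : 0 < L := by linarith
  have hm8 : |m| ≤ 8 * (L / v) := by norm_num at hm; linarith
  have hξ4 : v / 4 ≤ |ξ| := by norm_num at hξ; linarith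
  have hξ4' : |ξ| ≤ 4 * v := by norm_num at hξ'; linarith
  have hξ0 : ξ ≠ 0 := abs_pos.1 (lt_of_lt_of_le (by positivity) hξ4)
  have hσ1 : |σ| = 1 := by rcases hσ with rfl | rfl <;> simp
  have hfreq := abs_le_abs_rescaled_frequency y hv hv1 hL hm8 hσ1 ht hξ4 hξ4'
  have hc : |t * ξ / L ^ 2| ≤ 4 := by
    rw [abs_div, abs_mul, abs_of_pos (pow_pos hL0 2), div_le_iff₀ (by positivity)]
    nlinarith [abs_nonneg t, abs_nonneg ξ]
  have hI := hdecay (ξ / L * (y + 2 * t * (m - σ * √3 * ξ))) _ hc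
  rw [norm_oscIntAng μ₀ l m σ y t hξ0, ← hLdef]
  set b := ξ / L * (y + 2 * t * (m - σ * √3 * ξ))
  set N := ‖∫ s, ((μ₀ s ^ 2 : ℝ) : ℂ) * quadPhase b (t * ξ / L ^ 2) s‖
  have hN : 0 ≤ N := norm_nonneg _
  have hz : 0 ≤ v / L * |y| := by positivity
  have hsq : (1 + v / L * |y|) ^ 2 ≤ 2 * 513 ^ 2 * (1 + b ^ 2) := by
    have h1 : 1 + v / L * |y| ≤ 513 * (1 + |b|) := by linarith [abs_nonneg b]
    calc (1 + v / L * |y|) ^ 2 ≤ (513 * (1 + |b|)) ^ 2 := by gcongr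
      _ ≤ _ := by nlinarith [sq_nonneg (1 - |b|), sq_abs b]
  have hNz : N ≤ 2 * 513 ^ 2 * M / (1 + v / L * |y|) ^ 2 := by
    rw [le_div_iff₀ (by positivity)]
    nlinarith [mul_le_mul_of_nonneg_left hsq hN]
  calc |ξ| / L * N ≤ 4 * v / L * (2 * 513 ^ 2 * M / (1 + v / L * |y|) ^ 2) := by gcongr
    _ = _ := by rw [div_eq_mul_inv _ ((1 + v / L * |y|) ^ 2)]; ring
end
end

section
/- There exists a universal constant C > 0 such that for all integers k ≥ 0 and l ≥ 2k, all m ∈ ℝ with |m| ≤ 2^{l−k+3}, and each sign σ ∈ {+1, −1}, ∫_ℝ sup_{x ∈ ℝ, |t| ≤ 1} | ∫_{ℝ²} χ_{[k−1,k+1]}(ξ)² · μ₀(2^l(μ/ξ + σ√3ξ − m))² · e^{i(xξ + yμ + tω(ξ,μ))} dξ dμ | dy ≤ C. -/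
open MeasureTheory Real Set

noncomputable section

/-- The KP-I dispersion relation `ω(ξ,μ) = ξ³ + μ²/ξ`. -/
def disp (ξ μ : ℝ) : ℝ := ξ ^ 3 + μ ^ 2 / ξ

/-- `χ_m(ξ) = μ₀(ξ/2^m) − μ₀(ξ/2^{m−1})`. -/
def chi (μ₀ : ℝ → ℝ) (m : ℤ) (ξ : ℝ) : ℝ := μ₀ (ξ / 2 ^ m) - μ₀ (ξ / 2 ^ (m - 1))

/-- `χ_{[k₁,k₂]} = Σ_{m=k₁}^{k₂} χ_m`. -/
def chiI (μ₀ : ℝ → ℝ) (k₁ k₂ : ℤ) (ξ : ℝ) : ℝ := ∑ m ∈ Finset.Icc k₁ k₂, chi μ₀ m ξ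

/-- The first derivative test for oscillatory integrals, with a phase of one-signed convexity. -/
lemma norm_integral_exp_le_of_le_abs_deriv {φ φ' φ'' : ℝ → ℝ} (h1 : ∀ x, HasDerivAt φ (φ' x) x)
    (h2 : ∀ x, HasDerivAt φ' (φ'' x) x) (hc : Continuous φ'') {a b r : ℝ} (hab : a ≤ b)
    (hr : 0 < r) (hge : ∀ x ∈ Icc a b, r ≤ |φ' x|)
    (hsgn : (∀ x ∈ Icc a b, 0 ≤ φ'' x) ∨ (∀ x ∈ Icc a b, φ'' x ≤ 0)) :
    ‖∫ x in a..b, Complex.exp (Complex.I * (φ x : ℂ))‖ ≤ 4 / r := by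
  have hne : ∀ x ∈ Icc a b, φ' x ≠ 0 := fun x hx h => by
    have := hge x hx
    simp [h] at this
    linarith
  have hcφ : Continuous φ := continuous_iff_continuousAt.2 fun x => (h1 x).continuousAt
  have hcφ' : Continuous φ' := continuous_iff_continuousAt.2 fun x => (h2 x).continuousAt
  have huIcc : uIcc a b = Icc a b := uIcc_of_le hab
  have hinv : ∀ x ∈ Icc a b, |(φ' x)⁻¹| ≤ 1 / r := fun x hx => by
    rw [abs_inv, ← one_div]
    exact one_div_le_one_div_of_le hr (hge x hx)
  let E : ℝ → ℂ := fun x => Complex.exp (Complex.I * (φ x : ℂ))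
  have hE : ∀ x, HasDerivAt E (E x * (Complex.I * φ' x)) x := fun x =>
    ((h1 x).ofReal_comp.const_mul Complex.I).cexp
  have hEc : Continuous E := by fun_prop
  have hEn : ∀ x, ‖E x‖ = 1 := fun x => by
    simp only [E, mul_comm Complex.I]
    exact Complex.norm_exp_ofReal_mul_I _
  let q : ℝ → ℝ := fun x => φ'' x / φ' x ^ 2
  have hqc : ContinuousOn q (Icc a b) := by
    apply ContinuousOn.div hc.continuousOn (hcφ'.pow 2).continuousOn
    intro x hx
    exact pow_ne_zero 2 (hne x hx)
  have hqder : ∀ x ∈ Icc a b, HasDerivAt (fun x => (φ' x)⁻¹) (-q x) x := fun x hx => by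
    exact ((h2 x).inv (hne x hx)).congr_deriv (neg_div _ _)
  have hqint : ∫ x in a..b, -q x = (φ' b)⁻¹ - (φ' a)⁻¹ := by
    apply intervalIntegral.integral_eq_sub_of_hasDerivAt
    · rwa [huIcc]
    · apply ContinuousOn.intervalIntegrable
      rw [huIcc]; exact hqc.neg
  have hqi : |∫ x in a..b, q x| ≤ 2 / r := by
    rw [intervalIntegral.integral_neg] at hqint
    rw [← abs_neg, hqint]
    calc _ ≤ |(φ' b)⁻¹| + |(φ' a)⁻¹| := abs_sub _ _
      _ ≤ 1 / r + 1 / r := add_le_add (hinv b ⟨hab, le_rfl⟩) (hinv a ⟨le_rfl, hab⟩)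
      _ = 2 / r := by ring
  have hqabs : ∫ x in a..b, |q x| ≤ 2 / r := by
    rcases hsgn with h | h
    · have : ∫ x in a..b, |q x| = ∫ x in a..b, q x := by
        apply intervalIntegral.integral_congr
        intro x hx
        rw [huIcc] at hx
        exact abs_of_nonneg (div_nonneg (h x hx) (sq_nonneg _))
      rw [this]
      exact (le_abs_self _).trans hqi
    · have : ∫ x in a..b, |q x| = ∫ x in a..b, -q x := by
        apply intervalIntegral.integral_congr
        intro x hx
        rw [huIcc] at hx
        exact abs_of_nonpos (div_nonpos_of_nonpos_of_nonneg (h x hx) (sq_nonneg _))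
      rw [this, intervalIntegral.integral_neg]
      exact (neg_le_abs _).trans hqi
  let G : ℝ → ℂ := fun x => (((φ' x)⁻¹ : ℝ) : ℂ) * E x
  have hG : ∀ x ∈ Icc a b,
      HasDerivAt G (Complex.I * E x - (q x : ℂ) * E x) x := fun x hx => by
    have h := (hqder x hx).ofReal_comp.mul (hE x)
    refine h.congr_deriv ?_
    have : (φ' x : ℂ) ≠ 0 := by exact_mod_cast hne x hx
    push_cast
    field_simp
    ring
  have hqEc : ContinuousOn (fun x => (q x : ℂ) * E x) (Icc a b) :=
    (Complex.continuous_ofReal.comp_continuousOn hqc).mul hEc.continuousOn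
  have hIE : IntervalIntegrable (fun x => Complex.I * E x) volume a b :=
    (continuous_const.mul hEc).intervalIntegrable _ _
  have hIq : IntervalIntegrable (fun x => (q x : ℂ) * E x) volume a b := by
    apply ContinuousOn.intervalIntegrable
    rwa [huIcc]
  have hmain : ∫ x in a..b, (Complex.I * E x - (q x : ℂ) * E x) = G b - G a := by
    apply intervalIntegral.integral_eq_sub_of_hasDerivAt
    · rwa [huIcc]
    · exact hIE.sub hIq
  rw [intervalIntegral.integral_sub hIE hIq, intervalIntegral.integral_const_mul] at hmain
  have hGn : ∀ x ∈ Icc a b, ‖G x‖ ≤ 1 / r := fun x hx => by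
    simp only [G, norm_mul, hEn, mul_one, Complex.norm_real, Real.norm_eq_abs]
    exact hinv x hx
  have hqE : ‖∫ x in a..b, (q x : ℂ) * E x‖ ≤ 2 / r := by
    refine (intervalIntegral.norm_integral_le_integral_norm hab).trans ?_
    simpa [norm_mul, hEn] using hqabs
  have : ‖∫ x in a..b, E x‖ = ‖(G b - G a) + ∫ x in a..b, (q x : ℂ) * E x‖ := by
    rw [← hmain]
    simp
  calc _ = ‖(G b - G a) + ∫ x in a..b, (q x : ℂ) * E x‖ := this
    _ ≤ ‖G b - G a‖ + 2 / r := (norm_add_le _ _).trans (by gcongr)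
    _ ≤ (1 / r + 1 / r) + 2 / r := by
        gcongr
        exact (norm_sub_le _ _).trans
          (add_le_add (hGn b ⟨hab, le_rfl⟩) (hGn a ⟨le_rfl, hab⟩))
    _ = 4 / r := by ring

/-- If an integrand of norm at most one has integral at most `M` on every subinterval
avoiding the `d`-neighbourhood of `c`, then its integral is at most `2 * d + 2 * M`. -/
lemma norm_integral_le_of_avoid {E : ℝ → ℂ} (hEc : Continuous E) (hE : ∀ x, ‖E x‖ ≤ 1)
    {a b c d M : ℝ} (hab : a ≤ b) (hd : 0 < d) (hM : 0 ≤ M)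
    (h : ∀ u v, a ≤ u → u ≤ v → v ≤ b → (∀ x ∈ Icc u v, d ≤ |x - c|) →
      ((∀ x ∈ Icc u v, x ≤ c) ∨ (∀ x ∈ Icc u v, c ≤ x)) → ‖∫ x in u..v, E x‖ ≤ M) :
    ‖∫ x in a..b, E x‖ ≤ 2 * d + 2 * M := by
  have hi : ∀ u v, IntervalIntegrable E volume u v := fun u v => hEc.intervalIntegrable u v
  set p := max a (min b (c - d)) with hp
  set q := max a (min b (c + d)) with hq
  have hap : a ≤ p := le_max_left _ _
  have hqb : q ≤ b := max_le hab (min_le_left _ _)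
  have hpq : p ≤ q := max_le_max le_rfl (min_le_min le_rfl (by linarith))
  have hlen : q - p ≤ 2 * d := by
    rcases max_cases a (min b (c - d)) with h1 | h1 <;>
      rcases max_cases a (min b (c + d)) with h2 | h2 <;>
      rcases min_cases b (c - d) with h3 | h3 <;>
      rcases min_cases b (c + d) with h4 | h4 <;> linarith
  have e1 : ‖∫ x in a..p, E x‖ ≤ M := by
    rcases hap.eq_or_lt with h0 | h0
    · rw [← h0]; simpa
    have hpc : p ≤ c - d := by
      rcases max_cases a (min b (c - d)) with h1 | h1 <;>
        rcases min_cases b (c - d) with h3 | h3 <;> linarith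
    refine h a p le_rfl hap (hpq.trans hqb) (fun x hx => ?_) (.inl fun x hx => by linarith [hx.2])
    rw [abs_of_nonpos (by linarith [hx.2])]
    linarith [hx.2]
  have e3 : ‖∫ x in q..b, E x‖ ≤ M := by
    rcases hqb.eq_or_lt with h0 | h0
    · rw [h0]; simpa
    have hpc : c + d ≤ q := by
      rcases max_cases a (min b (c + d)) with h1 | h1 <;>
        rcases min_cases b (c + d) with h3 | h3 <;> linarith
    refine h q b (hap.trans hpq) hqb le_rfl (fun x hx => ?_) (.inr fun x hx => by linarith [hx.1])
    rw [abs_of_nonneg (by linarith [hx.1])]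
    linarith [hx.1]
  have e2 : ‖∫ x in p..q, E x‖ ≤ 2 * d := by
    have := intervalIntegral.norm_integral_le_of_norm_le_const (a := p) (b := q) (f := E) (C := 1)
      (fun x _ => hE x)
    rw [abs_of_nonneg (by linarith)] at this
    linarith
  rw [← intervalIntegral.integral_add_adjacent_intervals (hi a p) (hi p b),
    ← intervalIntegral.integral_add_adjacent_intervals (hi p q) (hi q b)]
  calc _ ≤ ‖∫ x in a..p, E x‖ + (‖∫ x in p..q, E x‖ + ‖∫ x in q..b, E x‖) :=
        (norm_add_le _ _).trans (by gcongr; exact norm_add_le _ _)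
    _ ≤ _ := by linarith

/-- A function on `[a, b]` whose derivative is at least `r` grows linearly away from
some point. -/
lemma exists_mul_abs_sub_le {g g' : ℝ → ℝ} (hg : ∀ x, HasDerivAt g (g' x) x) {a b r : ℝ}
    (hab : a ≤ b) (hge : ∀ x ∈ Icc a b, r ≤ g' x) :
    ∃ c, ∀ x ∈ Icc a b, r * |x - c| ≤ |g x| := by
  have hgc : Continuous g := continuous_iff_continuousAt.2 fun x => (hg x).continuousAt
  have hinc : ∀ x ∈ Icc a b, ∀ y ∈ Icc a b, x ≤ y → r * (y - x) ≤ g y - g x := by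
    intro x hx y hy hxy
    refine (convex_Icc a b).mul_sub_le_image_sub_of_le_deriv hgc.continuousOn
      (fun z _ => (hg z).differentiableAt.differentiableWithinAt) ?_ x hx y hy hxy
    intro z hz
    rw [(hg z).deriv]
    exact hge z (interior_subset hz)
  have ha : a ∈ Icc a b := ⟨le_rfl, hab⟩
  have hb : b ∈ Icc a b := ⟨hab, le_rfl⟩
  by_cases h1 : 0 ≤ g a
  · refine ⟨a, fun x hx => ?_⟩
    rw [abs_of_nonneg (by linarith [hx.1])]
    linarith [hinc a ha x hx hx.1, le_abs_self (g x)]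
  by_cases h2 : g b ≤ 0
  · refine ⟨b, fun x hx => ?_⟩
    rw [abs_of_nonpos (by linarith [hx.2])]
    linarith [hinc x hx b hb hx.2, neg_abs_le (g x)]
  obtain ⟨c, hc, hgc0⟩ := intermediate_value_Icc hab hgc.continuousOn
    (show (0 : ℝ) ∈ Icc (g a) (g b) from ⟨by linarith, by linarith⟩)
  refine ⟨c, fun x hx => ?_⟩
  rcases le_total c x with h | h
  · rw [abs_of_nonneg (by linarith)]
    linarith [hinc c hc x hx h, le_abs_self (g x)]
  · rw [abs_of_nonpos (by linarith)]
    linarith [hinc x hx c hc h, neg_abs_le (g x)]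

lemma norm_exp_I_mul_ofReal_le (θ : ℝ) : ‖Complex.exp (Complex.I * (θ : ℂ))‖ ≤ 1 := by
  rw [Complex.norm_exp_I_mul_ofReal]

/-- The second derivative test for oscillatory integrals. -/
lemma norm_integral_exp_le_of_le_deriv2 {φ φ' φ'' : ℝ → ℝ} (h1 : ∀ x, HasDerivAt φ (φ' x) x)
    (h2 : ∀ x, HasDerivAt φ' (φ'' x) x) (hc : Continuous φ'') {a b r : ℝ} (hab : a ≤ b)
    (hr : 0 < r) (hge : (∀ x ∈ Icc a b, r ≤ φ'' x) ∨ (∀ x ∈ Icc a b, φ'' x ≤ -r)) :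
    ‖∫ x in a..b, Complex.exp (Complex.I * (φ x : ℂ))‖ ≤ 10 * r ^ (-(1 / 2) : ℝ) := by
  have hcφ : Continuous φ := continuous_iff_continuousAt.2 fun x => (h1 x).continuousAt
  obtain ⟨c, hcx⟩ : ∃ c, ∀ x ∈ Icc a b, r * |x - c| ≤ |φ' x| := by
    rcases hge with h | h
    · exact exists_mul_abs_sub_le h2 hab h
    · obtain ⟨c, hc⟩ := exists_mul_abs_sub_le (fun x => (h2 x).neg) hab
        (fun x hx => by linarith [h x hx])
      exact ⟨c, fun x hx => by simpa using hc x hx⟩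
  set d := r ^ (-(1 / 2) : ℝ) with hd
  have hd0 : 0 < d := rpow_pos_of_pos hr _
  have hdr : r * d * d = 1 := by
    rw [hd, mul_assoc, ← rpow_add hr]
    norm_num [rpow_neg_one, hr.ne']
  have hrd : 4 / (r * d) = 4 * d := by
    rw [div_eq_iff (by positivity)]
    linarith
  have := norm_integral_le_of_avoid (E := fun x => Complex.exp (Complex.I * (φ x : ℂ)))
    (by fun_prop) (fun x => norm_exp_I_mul_ofReal_le _) (c := c) (d := d) (M := 4 * d) hab hd0
    (by positivity) (fun u v hu huv hv hav _ => by
      have hsub : Icc u v ⊆ Icc a b := Icc_subset_Icc hu hv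
      rw [← hrd]
      refine norm_integral_exp_le_of_le_abs_deriv h1 h2 hc huv (by positivity) (fun x hx => ?_) ?_
      · exact (mul_le_mul_of_nonneg_left (hav x hx) hr.le).trans (hcx x (hsub hx))
      · exact hge.imp (fun h x hx => hr.le.trans (h x (hsub hx)))
          (fun h x hx => (h x (hsub hx)).trans (by linarith)))
  linarith

/-- The third derivative test for oscillatory integrals with cubic phase. -/
lemma norm_integral_exp_cubic_le (α β γ : ℝ) (hγ : γ ≠ 0) {a b : ℝ} (hab : a ≤ b) :
    ‖∫ x in a..b, Complex.exp (Complex.I * ((α * x + β * x ^ 2 + γ * x ^ 3 : ℝ) : ℂ))‖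
      ≤ 22 * |γ| ^ (-(1 / 3) : ℝ) := by
  have h1 : ∀ x, HasDerivAt (fun x : ℝ => α * x + β * x ^ 2 + γ * x ^ 3)
      (α + 2 * β * x + 3 * γ * x ^ 2) x := fun x => by
    have := (((hasDerivAt_id x).const_mul α).add ((hasDerivAt_pow 2 x).const_mul β)).add
      ((hasDerivAt_pow 3 x).const_mul γ)
    refine this.congr_deriv ?_
    simp; ring
  have h2 : ∀ x, HasDerivAt (fun x : ℝ => α + 2 * β * x + 3 * γ * x ^ 2)
      (2 * β + 6 * γ * x) x := fun x => by
    have := (((hasDerivAt_id x).const_mul (2 * β)).const_add α).add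
      ((hasDerivAt_pow 2 x).const_mul (3 * γ))
    refine this.congr_deriv ?_
    simp; ring
  set c := -(2 * β) / (6 * γ) with hc
  have hphi : ∀ x, 2 * β + 6 * γ * x = 6 * γ * (x - c) := fun x => by
    rw [hc]; field_simp; ring
  have hg : 0 < |γ| := abs_pos.2 hγ
  set d := |γ| ^ (-(1 / 3) : ℝ) with hd
  have hd0 : 0 < d := rpow_pos_of_pos hg _
  have hr : (|γ| * d) ^ (-(1 / 2) : ℝ) = d := by
    rw [mul_rpow hg.le hd0.le, hd, ← rpow_mul hg.le, ← rpow_add hg]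
    norm_num
  have hgd : 0 < |γ| * d := by positivity
  have := norm_integral_le_of_avoid
    (E := fun x => Complex.exp (Complex.I * ((α * x + β * x ^ 2 + γ * x ^ 3 : ℝ) : ℂ)))
    (by fun_prop) (fun x => norm_exp_I_mul_ofReal_le _) (c := c) (d := d) (M := 10 * d) hab hd0
    (by positivity) (fun u v hu huv hv hav hside => by
      refine le_of_le_of_eq ?_ (congrArg (10 * ·) hr)
      refine norm_integral_exp_le_of_le_deriv2 h1 h2 (by fun_prop) huv hgd ?_
      have key : ∀ x ∈ Icc u v, |γ| * d ≤ |2 * β + 6 * γ * x| := fun x hx => by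
        rw [hphi, abs_mul, abs_mul, abs_of_pos (by norm_num : (0 : ℝ) < 6)]
        have := mul_le_mul_of_nonneg_left (hav x hx) hg.le
        nlinarith
      have hsign : (∀ x ∈ Icc u v, 0 ≤ 2 * β + 6 * γ * x) ∨
          (∀ x ∈ Icc u v, 2 * β + 6 * γ * x ≤ 0) := by
        simp only [hphi]
        rcases lt_or_gt_of_ne hγ with hγ | hγ <;> rcases hside with hs | hs
        · exact .inl fun x hx => by nlinarith [hs x hx]
        · exact .inr fun x hx => by nlinarith [hs x hx]
        · exact .inr fun x hx => by nlinarith [hs x hx]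
        · exact .inl fun x hx => by nlinarith [hs x hx]
      refine hsign.imp (fun h x hx => ?_) (fun h x hx => ?_)
      · have := key x hx
        rwa [abs_of_nonneg (h x hx)] at this
      · have := key x hx
        rw [abs_of_nonpos (h x hx)] at this
        linarith)
  linarith

/-- Partial integration: an amplitude vanishing at the right endpoint costs its total
variation. -/
lemma norm_integral_mul_le_of_deriv_le {ψ ψ' : ℝ → ℝ} (hψ : ∀ x, HasDerivAt ψ (ψ' x) x)
    (hψ' : Continuous ψ') {E : ℝ → ℂ} (hE : Continuous E) {a b B M : ℝ} (hab : a ≤ b)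
    (hb : ψ b = 0) (hB : ∀ x ∈ Icc a b, |ψ' x| ≤ B)
    (hM : ∀ v, a ≤ v → v ≤ b → ‖∫ x in a..v, E x‖ ≤ M) :
    ‖∫ x in a..b, (ψ x : ℂ) * E x‖ ≤ B * M * (b - a) := by
  have hF : ∀ x, HasDerivAt (fun v => ∫ x in a..v, E x) (E x) x := fun x =>
    intervalIntegral.integral_hasDerivAt_right (hE.intervalIntegrable _ _)
      (hE.stronglyMeasurableAtFilter _ _) hE.continuousAt
  have h := intervalIntegral.integral_mul_deriv_eq_deriv_mul (a := a) (b := b)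
    (u := fun x => (ψ x : ℂ)) (u' := fun x => (ψ' x : ℂ))
    (fun x _ => (hψ x).ofReal_comp) (fun x _ => hF x)
    ((Complex.continuous_ofReal.comp hψ').intervalIntegrable _ _) (hE.intervalIntegrable _ _)
  rw [h, hb]
  simp only [Complex.ofReal_zero, zero_mul, intervalIntegral.integral_same, mul_zero, sub_zero,
    zero_sub, norm_neg]
  have := intervalIntegral.norm_integral_le_of_norm_le_const (a := a) (b := b) (C := B * M)
    (f := fun x => (ψ' x : ℂ) * ∫ y in a..x, E y) (fun x hx => by
      rw [uIoc_of_le hab] at hx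
      rw [norm_mul, Complex.norm_real]
      have hx' : x ∈ Icc a b := ⟨hx.1.le, hx.2⟩
      exact mul_le_mul (hB x hx') (hM x hx.1.le hx.2) (norm_nonneg _)
        ((abs_nonneg _).trans (hB x hx')))
  rwa [abs_of_nonneg (by linarith)] at this

/-- Two partial integrations against a linear phase. -/
lemma norm_integral_mul_exp_linear_le {g g' g'' : ℝ → ℂ} (h1 : ∀ x, HasDerivAt g (g' x) x)
    (h2 : ∀ x, HasDerivAt g' (g'' x) x) (hc : Continuous g'') {a c ν B : ℝ} (hac : a ≤ c)
    (hν : ν ≠ 0) (ha : g a = 0) (hb : g c = 0) (ha' : g' a = 0) (hb' : g' c = 0)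
    (hB : ∀ x ∈ Icc a c, ‖g'' x‖ ≤ B) :
    ‖∫ x in a..c, g x * Complex.exp (Complex.I * ((ν * x : ℝ) : ℂ))‖ ≤ B * (c - a) / ν ^ 2 := by
  let E : ℝ → ℂ := fun x => Complex.exp (Complex.I * ((ν * x : ℝ) : ℂ))
  have hE : ∀ x, HasDerivAt E (E x * (Complex.I * ν)) x := fun x => by
    have := (((hasDerivAt_id x).const_mul ν).ofReal_comp.const_mul Complex.I).cexp
    simpa [E] using this
  have hEc : Continuous E := by fun_prop
  have hEn : ∀ x, ‖E x‖ = 1 := fun x => Complex.norm_exp_I_mul_ofReal _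
  have hg'c : Continuous g' := continuous_iff_continuousAt.2 fun x => (h2 x).continuousAt
  have hE'c : Continuous fun x => E x * (Complex.I * ν) := by fun_prop
  have s1 := intervalIntegral.integral_mul_deriv_eq_deriv_mul (a := a) (b := c)
    (fun x _ => h1 x) (fun x _ => hE x) (hg'c.intervalIntegrable _ _)
    (hE'c.intervalIntegrable _ _)
  have s2 := intervalIntegral.integral_mul_deriv_eq_deriv_mul (a := a) (b := c)
    (fun x _ => h2 x) (fun x _ => hE x) (hc.intervalIntegrable _ _)
    (hE'c.intervalIntegrable _ _)
  simp only [ha, hb, ha', hb', zero_mul, sub_zero, zero_sub, ← mul_assoc,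
    intervalIntegral.integral_mul_const] at s1 s2
  have key : (∫ x in a..c, g x * E x) * (ν : ℂ) ^ 2 = -∫ x in a..c, g'' x * E x := by
    have : (∫ x in a..c, g x * E x) * Complex.I * ν * Complex.I * ν
        = ∫ x in a..c, g'' x * E x := by
      rw [s1, neg_mul, neg_mul, s2, neg_neg]
    rw [← this]
    linear_combination ((∫ x in a..c, g x * E x) * (ν : ℂ) ^ 2) * Complex.I_sq
  have hle : ‖∫ x in a..c, g'' x * E x‖ ≤ B * (c - a) := by
    have := intervalIntegral.norm_integral_le_of_norm_le_const (a := a) (b := c) (C := B)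
      (f := fun x => g'' x * E x) (fun x hx => by
        rw [uIoc_of_le hac] at hx
        rw [norm_mul, hEn, mul_one]
        exact hB x ⟨hx.1.le, hx.2⟩)
    rwa [abs_of_nonneg (by linarith)] at this
  have hn := congrArg norm key
  rw [norm_mul, norm_neg, norm_pow, Complex.norm_real, Real.norm_eq_abs, sq_abs] at hn
  rw [le_div_iff₀ (by positivity)]
  exact hn.trans_le hle

/-- Decay of the Fourier transform of a bump multiplied by a chirp of bounded rate. -/
lemma exists_bound_integral_mul_exp_quadratic {f : ℝ → ℝ} (hf : ContDiff ℝ 2 f)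
    (hsupp : ∀ x, 8 / 5 < |x| → f x = 0) :
    ∃ B, 0 ≤ B ∧ ∀ ν c : ℝ, ν ≠ 0 → |c| ≤ 4 →
      ‖∫ s : ℝ, (f s : ℂ) * Complex.exp (Complex.I * ((ν * s + c * s ^ 2 : ℝ) : ℂ))‖
        ≤ B / ν ^ 2 := by
  have hf1 : ContDiff ℝ 1 (deriv f) :=
    ((contDiff_succ_iff_deriv (n := 1)).1 (by simpa [one_add_one_eq_two] using hf)).2.2
  have hd1 : ∀ x, HasDerivAt f (deriv f x) x := fun x =>
    (hf.differentiable (by norm_num) x).hasDerivAt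
  have hd2 : ∀ x, HasDerivAt (deriv f) (deriv (deriv f) x) x := fun x =>
    (hf1.differentiable (by norm_num) x).hasDerivAt
  have hc2 : Continuous (deriv (deriv f)) := hf1.continuous_deriv le_rfl
  have hderiv0 : ∀ x, 8 / 5 < |x| → deriv f x = 0 := fun x hx => by
    have : f =ᶠ[nhds x] fun _ => 0 := by
      filter_upwards [(isOpen_lt continuous_const continuous_abs).mem_nhds hx] with y hy
      exact hsupp y hy
    rw [this.deriv_eq]
    simp
  obtain ⟨B0, hB0⟩ := (isCompact_Icc (a := (-2 : ℝ)) (b := 2)).exists_bound_of_continuousOn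
    hf.continuous.continuousOn
  obtain ⟨B1, hB1⟩ := (isCompact_Icc (a := (-2 : ℝ)) (b := 2)).exists_bound_of_continuousOn
    hf1.continuous.continuousOn
  obtain ⟨B2, hB2⟩ := (isCompact_Icc (a := (-2 : ℝ)) (b := 2)).exists_bound_of_continuousOn
    hc2.continuousOn
  have h0 : (0 : ℝ) ∈ Icc (-2 : ℝ) 2 := by norm_num
  have hB0' := (norm_nonneg _).trans (hB0 0 h0)
  have hB1' := (norm_nonneg _).trans (hB1 0 h0)
  have hB2' := (norm_nonneg _).trans (hB2 0 h0)
  refine ⟨(B2 + 32 * B1 + 264 * B0) * 4, by positivity, fun ν c hν hc => ?_⟩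
  let e : ℝ → ℂ := fun s => Complex.exp (Complex.I * ((c * s ^ 2 : ℝ) : ℂ))
  have hen : ∀ x, ‖e x‖ = 1 := fun x => Complex.norm_exp_I_mul_ofReal _
  have hec : Continuous e := by fun_prop
  have he : ∀ s, HasDerivAt e (e s * (2 * Complex.I * c * s)) s := fun s => by
    have := (((hasDerivAt_pow 2 s).const_mul c).ofReal_comp.const_mul Complex.I).cexp
    refine this.congr_deriv ?_
    simp [e]
    ring
  have hlin : ∀ s : ℝ, HasDerivAt (fun s : ℝ => 2 * Complex.I * c * s) (2 * Complex.I * c) s :=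
    fun s => by
      simpa using (hasDerivAt_id s).ofReal_comp.const_mul (2 * Complex.I * c)
  let g : ℝ → ℂ := fun s => (f s : ℂ) * e s
  let g' : ℝ → ℂ := fun s => (((deriv f s : ℝ) : ℂ) + f s * (2 * Complex.I * c * s)) * e s
  let g'' : ℝ → ℂ := fun s => (((deriv (deriv f) s : ℝ) : ℂ) + ((deriv f s : ℝ) : ℂ) * (4 * Complex.I * c * s)
    + f s * (2 * Complex.I * c - 4 * c ^ 2 * s ^ 2)) * e s
  have hg : ∀ s, HasDerivAt g (g' s) s := fun s => by
    refine ((hd1 s).ofReal_comp.mul (he s)).congr_deriv ?_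
    simp only [g']
    ring
  have hg' : ∀ s, HasDerivAt g' (g'' s) s := fun s => by
    refine (((hd2 s).ofReal_comp.add ((hd1 s).ofReal_comp.mul (hlin s))).mul
      (he s)).congr_deriv ?_
    simp only [g'', Pi.add_apply, Pi.mul_apply]
    linear_combination (4 * (c : ℂ) ^ 2 * s ^ 2 * f s * e s) * Complex.I_sq
  have hg''c : Continuous g'' := by
    have := hf.continuous
    have := hf1.continuous
    fun_prop
  have hm := norm_integral_mul_exp_linear_le hg hg' hg''c (a := -2) (c := 2) (ν := ν)
    (B := B2 + 32 * B1 + 264 * B0) (by norm_num) hν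
    (by simp [g, hsupp (-2) (by norm_num)]) (by simp [g, hsupp 2 (by norm_num)])
    (by simp [g', hsupp (-2) (by norm_num), hderiv0 (-2) (by norm_num)])
    (by simp [g', hsupp 2 (by norm_num), hderiv0 2 (by norm_num)])
    (fun s hs => by
      have hs2 : |s| ≤ 2 := abs_le.2 hs
      have hcs : |c| * |s| ≤ 8 := by
        calc |c| * |s| ≤ 4 * 2 := by gcongr
          _ = 8 := by norm_num
      simp only [g'', norm_mul, hen, mul_one]
      refine (norm_add_le _ _).trans (add_le_add ((norm_add_le _ _).trans (add_le_add ?_ ?_)) ?_)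
      · rw [Complex.norm_real]; exact hB2 s hs
      · rw [norm_mul, Complex.norm_real, mul_comm]
        refine mul_le_mul ?_ (hB1 s hs) (norm_nonneg _) (by norm_num)
        simp only [norm_mul, Complex.norm_I, Complex.norm_real, Real.norm_eq_abs,
          Complex.norm_ofNat]
        linarith
      · rw [norm_mul, Complex.norm_real, mul_comm]
        refine mul_le_mul ?_ (hB0 s hs) (norm_nonneg _) (by norm_num)
        refine (norm_sub_le _ _).trans ?_
        simp only [norm_mul, norm_pow, Complex.norm_I, Complex.norm_real, Real.norm_eq_abs,
          Complex.norm_ofNat]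
        nlinarith [abs_nonneg c, abs_nonneg s, mul_nonneg (abs_nonneg c) (abs_nonneg s)])
  have hsub : Function.support
      (fun s : ℝ => (f s : ℂ) * Complex.exp (Complex.I * ((ν * s + c * s ^ 2 : ℝ) : ℂ)))
      ⊆ Ioc (-2) 2 := by
    intro s hs
    have : ¬ 8 / 5 < |s| := fun h => hs (by simp [hsupp s h])
    have := abs_le.1 (not_lt.1 this)
    exact ⟨by linarith [this.1], by linarith [this.2]⟩
  rw [← intervalIntegral.integral_eq_integral_of_support_subset hsub]
  have hcongr : ∀ s : ℝ, (f s : ℂ) * Complex.exp (Complex.I * ((ν * s + c * s ^ 2 : ℝ) : ℂ))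
      = g s * Complex.exp (Complex.I * ((ν * s : ℝ) : ℂ)) := fun s => by
    simp only [g, e, mul_assoc, ← Complex.exp_add]
    push_cast
    ring_nf
  simp only [hcongr]
  norm_num at hm ⊢
  exact hm

/-- Oscillatory integrals against a dilated annular bump with weight `|ξ|`. -/
lemma exists_bound_integral_annular_mul {η : ℝ → ℝ} (hη : ContDiff ℝ 1 η)
    (hsupp : ∀ u, 16 / 5 < |u| → η u = 0) :
    ∃ B, 0 ≤ B ∧ ∀ X : ℝ, 0 < X → ∀ E : ℝ → ℂ, Continuous E → ∀ M : ℝ,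
      (∀ u v, -(4 * X) ≤ u → u ≤ v → v ≤ 4 * X → ‖∫ ξ in u..v, E ξ‖ ≤ M) →
      ‖∫ ξ : ℝ, ((η (ξ / X) * |ξ| : ℝ) : ℂ) * E ξ‖ ≤ B * X * M := by
  have hdc : Continuous (deriv η) := hη.continuous_deriv le_rfl
  have hηc := hη.continuous
  obtain ⟨B, hB⟩ := (isCompact_Icc (a := (-4 : ℝ)) (b := 4)).exists_bound_of_continuousOn
    (f := fun u => deriv η u * u + η u) (by fun_prop)
  have hB0 := (norm_nonneg _).trans (hB 0 (by norm_num))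
  refine ⟨8 * B, by positivity, fun X hX E hE M hM => ?_⟩
  have hψ : ∀ ξ, HasDerivAt (fun ξ => η (ξ / X) * ξ)
      (deriv η (ξ / X) * (ξ / X) + η (ξ / X)) ξ := fun ξ => by
    have h1 : HasDerivAt (fun ξ => η (ξ / X)) (deriv η (ξ / X) * (1 / X)) ξ :=
      ((hη.differentiable (by norm_num) (ξ / X)).hasDerivAt).comp ξ ((hasDerivAt_id ξ).div_const X)
    refine (h1.mul (hasDerivAt_id ξ)).congr_deriv ?_
    simp
    ring
  have hψc : Continuous fun ξ => deriv η (ξ / X) * (ξ / X) + η (ξ / X) := by fun_prop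
  have hbd : ∀ ξ, -(4 * X) ≤ ξ → ξ ≤ 4 * X →
      |deriv η (ξ / X) * (ξ / X) + η (ξ / X)| ≤ B := fun ξ h1 h2 => by
    refine hB (ξ / X) ⟨?_, ?_⟩
    · rw [le_div_iff₀ hX]; linarith
    · rw [div_le_iff₀ hX]; linarith
  have i1 := norm_integral_mul_le_of_deriv_le hψ hψc hE (a := 0) (b := 4 * X) (B := B) (M := M)
    (by positivity) (by
      rw [mul_div_cancel_right₀ _ hX.ne', hsupp 4 (by norm_num [abs_of_pos]), zero_mul])
    (fun ξ hξ => hbd ξ (by linarith [hξ.1]) hξ.2)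
    (fun v h1 h2 => hM 0 v (by linarith) h1 h2)
  have i2 := norm_integral_mul_le_of_deriv_le hψ hψc hE (a := -(4 * X)) (b := 0) (B := B) (M := M)
    (by linarith) (by simp)
    (fun ξ hξ => hbd ξ hξ.1 (by linarith [hξ.2]))
    (fun v h1 h2 => hM _ v le_rfl h1 (by linarith))
  have hsub : Function.support (fun ξ : ℝ => ((η (ξ / X) * |ξ| : ℝ) : ℂ) * E ξ)
      ⊆ Ioc (-(4 * X)) (4 * X) := by
    intro ξ hξ
    have h : ¬ 16 / 5 < |ξ / X| := fun h => hξ (by simp [hsupp _ h])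
    rw [not_lt, abs_div, abs_of_pos hX, div_le_iff₀ hX] at h
    have := abs_le.1 h
    exact ⟨by linarith [this.1], by linarith [this.2]⟩
  have hint : ∀ u v, IntervalIntegrable (fun ξ : ℝ => ((η (ξ / X) * |ξ| : ℝ) : ℂ) * E ξ)
      volume u v := fun u v => by
    apply Continuous.intervalIntegrable
    fun_prop
  rw [← intervalIntegral.integral_eq_integral_of_support_subset hsub,
    ← intervalIntegral.integral_add_adjacent_intervals (hint _ 0) (hint 0 _)]
  have e1 : ∫ ξ in 0..4 * X, ((η (ξ / X) * |ξ| : ℝ) : ℂ) * E ξ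
      = ∫ ξ in 0..4 * X, ((η (ξ / X) * ξ : ℝ) : ℂ) * E ξ := by
    apply intervalIntegral.integral_congr
    intro ξ hξ
    rw [uIcc_of_le (by positivity)] at hξ
    simp only [abs_of_nonneg hξ.1]
  have e2 : ∫ ξ in -(4 * X)..0, ((η (ξ / X) * |ξ| : ℝ) : ℂ) * E ξ
      = -∫ ξ in -(4 * X)..0, ((η (ξ / X) * ξ : ℝ) : ℂ) * E ξ := by
    rw [← intervalIntegral.integral_neg]
    apply intervalIntegral.integral_congr
    intro ξ hξ
    rw [uIcc_of_le (by linarith)] at hξ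
    simp only [abs_of_nonpos hξ.2]
    push_cast
    ring
  rw [e1, e2]
  refine (norm_add_le _ _).trans ?_
  rw [norm_neg]
  linarith

/-- The phase `x ξ + y μ + t ω(ξ, μ)` in the coordinates `(ξ, s)` with
`μ = ξ (m - σ ξ + s / L)`. -/
def shearedPhase (x y t m σ L ξ s : ℝ) : ℝ :=
  x * ξ + y * (ξ * (m - σ * ξ + s / L)) + t * (ξ ^ 3 + ξ * (m - σ * ξ + s / L) ^ 2)

lemma continuous_shearedPhase (x y t m σ L : ℝ) :
    Continuous fun p : ℝ × ℝ => shearedPhase x y t m σ L p.1 p.2 := by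
  unfold shearedPhase
  fun_prop

/-- The integrand of the kernel, with cutoff `η` in frequency and `f` in angle. -/
def kernelIntegrand (η f : ℝ → ℝ) (X L m σ x y t : ℝ) (q : ℝ × ℝ) : ℂ :=
  ((η (q.1 / X) * f (L * (q.2 / q.1 + σ * q.1 - m)) : ℝ) : ℂ) *
    Complex.exp (Complex.I * ((x * q.1 + y * q.2 + t * disp q.1 q.2 : ℝ) : ℂ))

/-- The integrand of the kernel in sheared coordinates. -/
def shearedIntegrand (η f : ℝ → ℝ) (X L m σ x y t : ℝ) (ξ s : ℝ) : ℂ :=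
  ((L⁻¹ * (η (ξ / X) * |ξ|) * f s : ℝ) : ℂ) *
    Complex.exp (Complex.I * (shearedPhase x y t m σ L ξ s : ℂ))

lemma integral_kernelIntegrand_snd {η f : ℝ → ℝ} (h0 : η 0 = 0) {X L : ℝ} (hL : 0 < L)
    (m σ x y t ξ : ℝ) :
    ∫ μ : ℝ, kernelIntegrand η f X L m σ x y t (ξ, μ)
      = ∫ s : ℝ, shearedIntegrand η f X L m σ x y t ξ s := by
  rcases eq_or_ne ξ 0 with rfl | hξ
  · simp [kernelIntegrand, shearedIntegrand, h0]
  set g : ℝ → ℂ := fun μ => kernelIntegrand η f X L m σ x y t (ξ, μ) with hg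
  set d := ξ * (m - σ * ξ) with hd
  have hξL : ξ / L ≠ 0 := div_ne_zero hξ hL.ne'
  have h1 := Measure.integral_comp_mul_left (fun z => g (z + d)) (ξ / L)
  rw [integral_add_right_eq_self g d] at h1
  have h2 : ∫ μ, g μ = |ξ / L| • ∫ s, g (ξ / L * s + d) := by
    rw [h1, smul_smul, ← abs_mul, mul_inv_cancel₀ hξL, abs_one, one_smul]
  rw [h2, ← integral_smul]
  congr 1
  ext s
  have e1 : (ξ / L * s + d) / ξ = m - σ * ξ + s / L := by
    rw [hd]; field_simp; ring
  have e2 : L * ((ξ / L * s + d) / ξ + σ * ξ - m) = s := by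
    rw [e1]; field_simp; ring
  have e3 : ξ / L * s + d = ξ * (m - σ * ξ + s / L) := by
    rw [hd]; field_simp; ring
  have e4 : x * ξ + y * (ξ / L * s + d) + t * disp ξ (ξ / L * s + d)
      = shearedPhase x y t m σ L ξ s := by
    unfold shearedPhase disp
    rw [e3]
    field_simp
  simp only [hg, kernelIntegrand, shearedIntegrand, e2, e4, abs_div, abs_of_pos hL,
    Complex.real_smul]
  push_cast
  ring

lemma integrable_shearedIntegrand {η f : ℝ → ℝ} (hη : Continuous η) (hf : Continuous f)
    (hηs : ∀ u, 16 / 5 < |u| → η u = 0) (hfs : ∀ s, 8 / 5 < |s| → f s = 0) {X : ℝ} (hX : 0 < X)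
    (L m σ x y t : ℝ) :
    Integrable (Function.uncurry (shearedIntegrand η f X L m σ x y t))
      (volume.prod volume) := by
  have hc : Continuous (Function.uncurry (shearedIntegrand η f X L m σ x y t)) := by
    have := continuous_shearedPhase x y t m σ L
    unfold Function.uncurry shearedIntegrand
    fun_prop
  refine hc.integrable_of_hasCompactSupport
    (HasCompactSupport.intro ((isCompact_Icc (a := -(4 * X)) (b := 4 * X)).prod
      (isCompact_Icc (a := (-2 : ℝ)) (b := 2))) ?_)
  rintro ⟨ξ, s⟩ hp
  simp only [Function.uncurry, shearedIntegrand]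
  rw [mem_prod, not_and_or] at hp
  rcases hp with hp | hp
  · rw [hηs]
    · simp
    rw [abs_div, abs_of_pos hX, lt_div_iff₀ hX]
    by_contra! h
    have := abs_le.1 h
    exact hp ⟨by simp only; linarith [this.1], by simp only; linarith [this.2]⟩
  · rw [hfs]
    · simp
    by_contra! h
    have := abs_le.1 h
    exact hp ⟨by simp only; linarith [this.1], by simp only; linarith [this.2]⟩

/-- The scaling profile of the kernel for `|y| ≲ 2 ^ (l - k)`. -/
def nearProfile (u : ℝ) : ℝ := if |u| ≤ 100 then |u| ^ (-(1 / 3) : ℝ) else 0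

/-- The scaling profile of the kernel away from the region of `nearProfile`. -/
def farProfile (u : ℝ) : ℝ := if |u| ≤ 100 then |u| ^ (-(1 / 2) : ℝ) else (u ^ 2)⁻¹

/-- An integrable majorant of the kernel, uniformly in `x` and `t`. -/
def kernelMajorant (N y : ℝ) : ℝ := N⁻¹ * nearProfile (y / N) + (N ^ 2)⁻¹ * farProfile (y / N ^ 2)

lemma nearProfile_nonneg (u : ℝ) : 0 ≤ nearProfile u := by
  unfold nearProfile; split_ifs <;> positivity

lemma farProfile_nonneg (u : ℝ) : 0 ≤ farProfile u := by
  unfold farProfile; split_ifs <;> positivity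

lemma integrable_ite_abs_rpow {r : ℝ} (hr : -1 < r) {g : ℝ → ℝ}
    (hg : IntegrableOn g (Icc (-100) 100)ᶜ) :
    Integrable fun u : ℝ => if |u| ≤ 100 then |u| ^ r else g u := by
  have h1 : IntegrableOn (fun u : ℝ => |u| ^ r) (Icc (-100) 100) := by
    have hp : IntervalIntegrable (fun u : ℝ => |u| ^ r) volume 0 100 := by
      refine (intervalIntegral.intervalIntegrable_rpow' hr).congr ?_
      intro u hu
      rw [uIoc_of_le (by norm_num)] at hu
      simp only [abs_of_pos hu.1]
    have hn : IntervalIntegrable (fun u : ℝ => |u| ^ r) volume (-100) 0 := by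
      have := hp.comp_sub_left 0
      simpa using this.symm
    exact (intervalIntegrable_iff_integrableOn_Icc_of_le (by norm_num)).1 (hn.trans hp)
  rw [← integrableOn_univ, ← union_compl_self (Icc (-100 : ℝ) 100)]
  refine IntegrableOn.union ?_ ?_
  · refine h1.congr_fun (fun u hu => ?_) measurableSet_Icc
    simp [abs_le.2 hu]
  · refine hg.congr_fun (fun u hu => ?_) measurableSet_Icc.compl
    have : ¬ |u| ≤ 100 := fun h => hu (abs_le.1 h)
    simp [this]

lemma integrable_nearProfile : Integrable nearProfile :=
  integrable_ite_abs_rpow (by norm_num) integrableOn_zero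

lemma integrable_farProfile : Integrable farProfile := by
  refine integrable_ite_abs_rpow (by norm_num) ?_
  have hfin : Integrable fun u : ℝ => 2 * (1 + u ^ 2)⁻¹ :=
    integrable_inv_one_add_sq.const_mul 2
  refine hfin.integrableOn.mono' (by fun_prop) ?_
  refine (ae_restrict_iff' measurableSet_Icc.compl).2 (.of_forall fun u hu => ?_)
  have h : 100 < |u| := by
    by_contra! h
    exact hu (abs_le.1 h)
  have h2 : (1 : ℝ) ≤ u ^ 2 := by
    rw [← sq_abs]
    nlinarith
  rw [norm_inv, Real.norm_eq_abs, abs_of_nonneg (sq_nonneg u), ← div_eq_mul_inv,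
    inv_eq_one_div, div_le_div_iff₀ (by positivity) (by positivity)]
  linarith

lemma integrable_kernelMajorant {N : ℝ} (hN : 0 < N) : Integrable (kernelMajorant N) :=
  ((integrable_nearProfile.comp_div hN.ne').const_mul _).add
    ((integrable_farProfile.comp_div (by positivity)).const_mul _)

lemma integral_kernelMajorant {N : ℝ} (hN : 0 < N) :
    ∫ y, kernelMajorant N y = (∫ u, nearProfile u) + ∫ u, farProfile u := by
  unfold kernelMajorant
  rw [integral_add ((integrable_nearProfile.comp_div hN.ne').const_mul _)
    ((integrable_farProfile.comp_div (by positivity)).const_mul _), integral_const_mul,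
    integral_const_mul, Measure.integral_comp_div, Measure.integral_comp_div,
    abs_of_pos hN, abs_of_pos (by positivity : 0 < N ^ 2), smul_eq_mul, smul_eq_mul,
    inv_mul_cancel_left₀ hN.ne', inv_mul_cancel_left₀ (by positivity)]

/-- Uniform bound for the oscillatory integral in `ξ` at fixed `s`. -/
lemma norm_integral_exp_shearedPhase_le {X N L m σ y t s : ℝ} (hX : 0 < X) (hXN : X ≤ N)
    (hL : 1 ≤ L) (hN : 1 ≤ N) (hm : |m| ≤ 8 * N) (hσ : σ ^ 2 = 3) (hy : y ≠ 0) (ht : |t| ≤ 1)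
    (hs : |s| ≤ 2) (x : ℝ) {u v : ℝ} (hu : -(4 * X) ≤ u) (huv : u ≤ v) (hv : v ≤ 4 * X) :
    ‖∫ ξ in u..v, Complex.exp (Complex.I * (shearedPhase x y t m σ L ξ s : ℂ))‖
      ≤ 22 * (1 / 25) ^ (-(1 / 3) : ℝ) * nearProfile (y / N) + 10 * |y| ^ (-(1 / 2) : ℝ) := by
  have hN0 : 0 < N := by linarith
  have hy0 : 0 < |y| := abs_pos.2 hy
  set M := m + s / L with hM
  have hMb : |M| ≤ 10 * N := by
    have : |s / L| ≤ 2 := by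
      rw [abs_div, abs_of_pos (by linarith : 0 < L), div_le_iff₀ (by linarith)]
      linarith
    linarith [abs_add_le m (s / L)]
  set α := x + y * M + t * M ^ 2
  set β := -σ * (y + 2 * t * M)
  have hphase : ∀ ξ, shearedPhase x y t m σ L ξ s = α * ξ + β * ξ ^ 2 + (4 * t) * ξ ^ 3 :=
    fun ξ => by
      unfold shearedPhase
      simp only [α, β, hM]
      linear_combination (t * ξ ^ 3) * hσ
  simp only [hphase]
  by_cases hA : 100 * (|t| * N) ≤ |y|
  · have h1 : ∀ ξ, HasDerivAt (fun ξ : ℝ => α * ξ + β * ξ ^ 2 + (4 * t) * ξ ^ 3)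
        (α + 2 * β * ξ + 12 * t * ξ ^ 2) ξ := fun ξ => by
      refine ((((hasDerivAt_id ξ).const_mul α).add ((hasDerivAt_pow 2 ξ).const_mul β)).add
        ((hasDerivAt_pow 3 ξ).const_mul (4 * t))).congr_deriv ?_
      simp; ring
    have h2 : ∀ ξ, HasDerivAt (fun ξ : ℝ => α + 2 * β * ξ + 12 * t * ξ ^ 2)
        (2 * β + 24 * t * ξ) ξ := fun ξ => by
      refine ((((hasDerivAt_id ξ).const_mul (2 * β)).const_add α).add
        ((hasDerivAt_pow 2 ξ).const_mul (12 * t))).congr_deriv ?_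
      simp; ring
    have hσl : 17 / 10 ≤ |σ| := by
      by_contra! h
      nlinarith [sq_abs σ, abs_nonneg σ]
    have hσu : |σ| ≤ 9 / 5 := by
      by_contra! h
      nlinarith [sq_abs σ, abs_nonneg σ]
    have herr : ∀ ξ ∈ Icc u v, |-(4 * σ * t * M) + 24 * t * ξ| ≤ 2 * |y| := fun ξ hξ => by
      have hξ : |ξ| ≤ 4 * N := abs_le.2 ⟨by linarith [hξ.1], by linarith [hξ.2]⟩
      have e1 : |4 * σ * t * M| ≤ 72 * (|t| * N) := by
        rw [abs_mul, abs_mul, abs_mul, abs_of_pos (by norm_num : (0 : ℝ) < 4)]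
        calc 4 * |σ| * |t| * |M| ≤ 4 * (9 / 5) * |t| * (10 * N) := by gcongr
          _ = 72 * (|t| * N) := by ring
      have e2 : |24 * t * ξ| ≤ 96 * (|t| * N) := by
        rw [abs_mul, abs_mul, abs_of_pos (by norm_num : (0 : ℝ) < 24)]
        calc 24 * |t| * |ξ| ≤ 24 * |t| * (4 * N) := by gcongr
          _ = 96 * (|t| * N) := by ring
      have e3 := abs_add_le (-(4 * σ * t * M)) (24 * t * ξ)
      rw [abs_neg] at e3
      linarith
    have hσy : 17 / 10 * |y| ≤ |σ * y| := by
      rw [abs_mul]; gcongr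
    have hβ : ∀ ξ, 2 * β + 24 * t * ξ = -2 * (σ * y) + (-(4 * σ * t * M) + 24 * t * ξ) :=
      fun ξ => by simp only [β]; ring
    have := norm_integral_exp_le_of_le_deriv2 h1 h2 (by fun_prop) huv hy0 (by
      simp only [hβ]
      rcases le_total 0 (σ * y) with h | h
      · rw [abs_of_nonneg h] at hσy
        exact .inr fun ξ hξ => by linarith [(abs_le.1 (herr ξ hξ)).2]
      · rw [abs_of_nonpos h] at hσy
        exact .inl fun ξ hξ => by linarith [(abs_le.1 (herr ξ hξ)).1])
    refine this.trans (le_add_of_nonneg_left ?_)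
    have := nearProfile_nonneg (y / N)
    positivity
  · push Not at hA
    have ht0 : t ≠ 0 := by
      rintro rfl
      simp at hA
      linarith
    refine (norm_integral_exp_cubic_le α β (4 * t) (by simpa) huv).trans
      (le_trans ?_ (le_add_of_nonneg_right (by positivity)))
    have hyN : |y / N| = |y| / N := by rw [abs_div, abs_of_pos hN0]
    have hle : |y / N| ≤ 100 := by
      rw [hyN, div_le_iff₀ hN0]
      nlinarith
    rw [nearProfile, if_pos hle, mul_assoc, ← mul_rpow (by norm_num) (abs_nonneg _)]
    gcongr 22 * ?_
    refine rpow_le_rpow_of_nonpos (by rw [hyN]; positivity) ?_ (by norm_num)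
    rw [hyN, abs_mul, abs_of_pos (by norm_num : (0 : ℝ) < 4), ← mul_div_assoc, div_le_iff₀ hN0]
    linarith

section KernelBounds

variable {η f : ℝ → ℝ}

/-- The kernel bound from the oscillation in `ξ`. -/
lemma exists_norm_integral_sheared_le_of_le (hη : ContDiff ℝ 1 η) (hf : Continuous f)
    (hηs : ∀ u, 16 / 5 < |u| → η u = 0) (hfs : ∀ s, 8 / 5 < |s| → f s = 0) :
    ∃ A, 0 ≤ A ∧ ∀ X N m σ : ℝ, 1 ≤ X → X ≤ N → |m| ≤ 8 * N → σ ^ 2 = 3 → ∀ x y t : ℝ, y ≠ 0 →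
      |t| ≤ 1 → |y| ≤ 100 * N ^ 2 →
      ‖∫ ξ, ∫ s, shearedIntegrand η f X (X * N) m σ x y t ξ s‖ ≤ A * kernelMajorant N y := by
  obtain ⟨B, hB0, hB⟩ := exists_bound_integral_annular_mul hη hηs
  set F := ∫ s, |f s| with hF
  have hF0 : 0 ≤ F := integral_nonneg fun s => abs_nonneg _
  have hfi : Integrable f := by
    refine hf.integrable_of_hasCompactSupport
      (HasCompactSupport.intro (isCompact_Icc (a := (-2 : ℝ)) (b := 2)) fun s hs => hfs s ?_)
    by_contra! h
    have := abs_le.1 h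
    exact hs ⟨by linarith [this.1], by linarith [this.2]⟩
  set κ : ℝ := 22 * (1 / 25) ^ (-(1 / 3) : ℝ) with hκ
  have hκ0 : 0 ≤ κ := by positivity
  refine ⟨F * B * (κ + 10), by positivity, fun X N m σ hX hXN hm hσ x y t hy ht hyN => ?_⟩
  have hX0 : 0 < X := by linarith
  have hN : 1 ≤ N := hX.trans hXN
  have hN0 : 0 < N := by linarith
  have hL : 1 ≤ X * N := one_le_mul_of_one_le_of_one_le hX hN
  rw [integral_integral_swap (integrable_shearedIntegrand hη.continuous hf hηs hfs hX0 _ _ _ _ _ _)]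
  set M := κ * nearProfile (y / N) + 10 * |y| ^ (-(1 / 2) : ℝ) with hM
  have hbound : ∀ s, ‖∫ ξ, shearedIntegrand η f X (X * N) m σ x y t ξ s‖
      ≤ |f s| * (B * N⁻¹ * M) := fun s => by
    by_cases hs : 8 / 5 < |s|
    · simp [shearedIntegrand, hfs s hs]
    have hc : Continuous fun ξ =>
        Complex.exp (Complex.I * (shearedPhase x y t m σ (X * N) ξ s : ℂ)) := by
      unfold shearedPhase
      fun_prop
    have h := hB X hX0 _ hc M (fun u v hu huv hv =>
      norm_integral_exp_shearedPhase_le hX0 hXN hL hN hm hσ hy ht (by linarith) x hu huv hv)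
    have e : ∀ ξ, shearedIntegrand η f X (X * N) m σ x y t ξ s = (((X * N)⁻¹ * f s : ℝ) : ℂ) *
        (((η (ξ / X) * |ξ| : ℝ) : ℂ) *
          Complex.exp (Complex.I * (shearedPhase x y t m σ (X * N) ξ s : ℂ))) := fun ξ => by
      unfold shearedIntegrand
      push_cast
      ring
    simp only [e]
    rw [integral_const_mul, norm_mul, Complex.norm_real, Real.norm_eq_abs, abs_mul,
      abs_of_pos (by positivity : 0 < (X * N)⁻¹)]
    calc _ ≤ (X * N)⁻¹ * |f s| * (B * X * M) := by gcongr
      _ = _ := by field_simp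
  have hle := norm_integral_le_of_norm_le (hfi.abs.mul_const _) (.of_forall hbound)
  rw [integral_mul_const] at hle
  refine hle.trans ?_
  have hfar : N⁻¹ * |y| ^ (-(1 / 2) : ℝ) = (N ^ 2)⁻¹ * farProfile (y / N ^ 2) := by
    have h1 : |y / N ^ 2| = |y| / N ^ 2 := by rw [abs_div, abs_of_pos (by positivity : 0 < N ^ 2)]
    have h2 : |y / N ^ 2| ≤ 100 := by rwa [h1, div_le_iff₀ (by positivity)]
    have h3 : (N ^ 2) ^ (-(1 / 2) : ℝ) = N⁻¹ := by
      rw [← rpow_natCast, ← rpow_mul hN0.le, ← rpow_neg_one]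
      norm_num
    rw [farProfile, if_pos h2, h1, div_rpow (abs_nonneg _) (by positivity), h3]
    field_simp
  have hn := nearProfile_nonneg (y / N)
  have hn' := farProfile_nonneg (y / N ^ 2)
  have hmaj : N⁻¹ * M ≤ (κ + 10) * kernelMajorant N y := by
    have e : N⁻¹ * M = κ * (N⁻¹ * nearProfile (y / N))
        + 10 * ((N ^ 2)⁻¹ * farProfile (y / N ^ 2)) := by
      rw [← hfar, hM]; ring
    have p1 : 0 ≤ N⁻¹ * nearProfile (y / N) := by positivity
    have p2 : 0 ≤ (N ^ 2)⁻¹ * farProfile (y / N ^ 2) := by positivity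
    rw [e, kernelMajorant]
    nlinarith [mul_nonneg hκ0 p2]
  calc F * (B * N⁻¹ * M) = F * B * (N⁻¹ * M) := by ring
    _ ≤ F * B * ((κ + 10) * kernelMajorant N y) := by gcongr
    _ = _ := by ring

/-- The kernel bound from the oscillation in `s`. -/
lemma exists_norm_integral_sheared_le_of_lt (hη1 : ∀ u, |η u| ≤ 1) (hf : ContDiff ℝ 2 f)
    (hηs : ∀ u, 16 / 5 < |u| → η u = 0) (hηi : ∀ u, |u| < 1 / 4 → η u = 0)
    (hfs : ∀ s, 8 / 5 < |s| → f s = 0) :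
    ∃ A, 0 ≤ A ∧ ∀ X N m σ : ℝ, 1 ≤ X → X ≤ N → |m| ≤ 8 * N → σ ^ 2 = 3 → ∀ x y t : ℝ,
      |t| ≤ 1 → 100 * N ^ 2 < |y| →
      ‖∫ ξ, ∫ s, shearedIntegrand η f X (X * N) m σ x y t ξ s‖ ≤ A * kernelMajorant N y := by
  obtain ⟨B, hB0, hB⟩ := exists_bound_integral_mul_exp_quadratic hf hfs
  refine ⟨2048 * B, by positivity, fun X N m σ hX hXN hm hσ x y t ht hyN => ?_⟩
  have hX0 : 0 < X := by linarith
  have hN : 1 ≤ N := hX.trans hXN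
  have hN0 : 0 < N := by linarith
  have hL : 1 ≤ X * N := one_le_mul_of_one_le_of_one_le hX hN
  have hNN : N ≤ N ^ 2 := by nlinarith
  have hy0 : 0 < |y| := by linarith
  have hσu : |σ| ≤ 9 / 5 := by
    by_contra! h
    nlinarith [sq_abs σ, abs_nonneg σ]
  have hsub : Function.support (fun ξ => ∫ s, shearedIntegrand η f X (X * N) m σ x y t ξ s)
      ⊆ Ioc (-(4 * X)) (4 * X) := by
    intro ξ hξ
    have h : ¬ 16 / 5 < |ξ / X| := fun h => hξ (by simp [shearedIntegrand, hηs _ h])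
    rw [not_lt, abs_div, abs_of_pos hX0, div_le_iff₀ hX0] at h
    have := abs_le.1 h
    exact ⟨by linarith [this.1], by linarith [this.2]⟩
  rw [← intervalIntegral.integral_eq_integral_of_support_subset hsub]
  have hbound : ∀ ξ ∈ uIoc (-(4 * X)) (4 * X),
      ‖∫ s, shearedIntegrand η f X (X * N) m σ x y t ξ s‖ ≤ 256 * B * N / y ^ 2 := fun ξ hξ => by
    rw [uIoc_of_le (by linarith)] at hξ
    have hξu : |ξ| ≤ 4 * X := abs_le.2 ⟨hξ.1.le, hξ.2⟩
    by_cases hi : |ξ / X| < 1 / 4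
    · simp [shearedIntegrand, hηi _ hi]
      positivity
    have hξl : X / 4 ≤ |ξ| := by
      rw [not_lt, abs_div, abs_of_pos hX0, le_div_iff₀ hX0] at hi
      linarith
    set ν₀ := m - σ * ξ with hν₀
    have hν₀b : |2 * t * ν₀| ≤ 32 * N := by
      have h1 : |σ * ξ| ≤ 8 * N := by
        rw [abs_mul]
        calc |σ| * |ξ| ≤ 9 / 5 * (4 * X) := by gcongr
          _ ≤ 8 * N := by linarith
      have h2 : |ν₀| ≤ 16 * N := (abs_sub _ _).trans (by linarith)
      rw [abs_mul, abs_mul, abs_of_pos (by norm_num : (0 : ℝ) < 2)]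
      calc 2 * |t| * |ν₀| ≤ 2 * 1 * (16 * N) := by gcongr
        _ = 32 * N := by ring
    have hlow : |y| / 2 ≤ |y + 2 * t * ν₀| := by
      have := abs_sub_abs_le_abs_sub y (-(2 * t * ν₀))
      rw [abs_neg, sub_neg_eq_add] at this
      linarith
    set ν := ξ / (X * N) * (y + 2 * t * ν₀) with hν
    set c := t * ξ / (X * N) ^ 2 with hc
    have hνl : |y| / (8 * N) ≤ |ν| := by
      rw [hν, abs_mul, abs_div, abs_of_pos (by positivity : 0 < X * N)]
      calc |y| / (8 * N) = (X / 4) / (X * N) * (|y| / 2) := by field_simp; norm_num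
        _ ≤ _ := by gcongr
    have hν0 : ν ≠ 0 := abs_pos.1 (lt_of_lt_of_le (by positivity) hνl)
    have hcb : |c| ≤ 4 := by
      rw [hc, abs_div, abs_mul, abs_of_pos (by positivity : 0 < (X * N) ^ 2),
        div_le_iff₀ (by positivity)]
      calc |t| * |ξ| ≤ 1 * (4 * X) := by gcongr
        _ ≤ 4 * (X * N) ^ 2 := by nlinarith
    set d := x * ξ + y * (ξ * ν₀) + t * (ξ ^ 3 + ξ * ν₀ ^ 2) with hd
    have e : ∀ s, shearedIntegrand η f X (X * N) m σ x y t ξ s =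
        ((((X * N)⁻¹ * (η (ξ / X) * |ξ|) : ℝ) : ℂ) * Complex.exp (Complex.I * (d : ℂ))) *
          ((f s : ℂ) * Complex.exp (Complex.I * ((ν * s + c * s ^ 2 : ℝ) : ℂ))) := fun s => by
      have : shearedPhase x y t m σ (X * N) ξ s = d + (ν * s + c * s ^ 2) := by
        rw [shearedPhase, hd, hν, hc, hν₀]
        field_simp
        ring
      rw [shearedIntegrand, this, Complex.ofReal_add d, mul_add, Complex.exp_add]
      push_cast
      ring
    simp only [e]
    rw [integral_const_mul, norm_mul, norm_mul, Complex.norm_exp_I_mul_ofReal, mul_one,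
      Complex.norm_real, Real.norm_eq_abs, abs_mul, abs_mul, abs_abs,
      abs_of_pos (by positivity : 0 < (X * N)⁻¹)]
    have hν2 : B / ν ^ 2 ≤ B / (|y| / (8 * N)) ^ 2 := by
      rw [← sq_abs ν]
      gcongr
    calc _ ≤ (X * N)⁻¹ * (1 * (4 * X)) * (B / (|y| / (8 * N)) ^ 2) := by
          gcongr
          · exact hη1 _
          · exact (hB ν c hν0 hcb).trans hν2
      _ = 256 * B * N / y ^ 2 := by
          rw [div_pow, sq_abs]
          have : y ≠ 0 := abs_pos.1 hy0
          field_simp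
          ring
  refine (intervalIntegral.norm_integral_le_of_norm_le_const hbound).trans ?_
  rw [abs_of_nonneg (by linarith)]
  have hfar : N ^ 2 / y ^ 2 ≤ kernelMajorant N y := by
    have h1 : |y / N ^ 2| = |y| / N ^ 2 := by rw [abs_div, abs_of_pos (by positivity : 0 < N ^ 2)]
    have h2 : ¬ |y / N ^ 2| ≤ 100 := by
      rw [h1, div_le_iff₀ (by positivity)]
      linarith
    have hy : y ≠ 0 := abs_pos.1 hy0
    rw [kernelMajorant, farProfile, if_neg h2]
    have := nearProfile_nonneg (y / N)
    have e : (N ^ 2)⁻¹ * ((y / N ^ 2) ^ 2)⁻¹ = N ^ 2 / y ^ 2 := by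
      field_simp
    rw [e]
    exact le_add_of_nonneg_left (by positivity)
  calc 256 * B * N / y ^ 2 * (4 * X - -(4 * X)) = 2048 * B * (N * X / y ^ 2) := by ring
    _ ≤ 2048 * B * (N ^ 2 / y ^ 2) := by
        rw [sq N]
        gcongr
    _ ≤ _ := by gcongr

/-- Uniform pointwise domination of the kernel. -/
lemma exists_norm_integral_kernelIntegrand_le (hη : ContDiff ℝ 1 η) (hη1 : ∀ u, |η u| ≤ 1)
    (hf : ContDiff ℝ 2 f) (hηs : ∀ u, 16 / 5 < |u| → η u = 0)
    (hηi : ∀ u, |u| < 1 / 4 → η u = 0) (hfs : ∀ s, 8 / 5 < |s| → f s = 0) :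
    ∃ A, 0 ≤ A ∧ ∀ X N m σ : ℝ, 1 ≤ X → X ≤ N → |m| ≤ 8 * N → σ ^ 2 = 3 → ∀ x y t : ℝ, y ≠ 0 →
      |t| ≤ 1 →
      ‖∫ q, kernelIntegrand η f X (X * N) m σ x y t q‖ ≤ A * kernelMajorant N y := by
  obtain ⟨A₁, hA₁, h₁⟩ := exists_norm_integral_sheared_le_of_le hη hf.continuous hηs hfs
  obtain ⟨A₂, hA₂, h₂⟩ := exists_norm_integral_sheared_le_of_lt hη1 hf hηs hηi hfs
  refine ⟨A₁ + A₂, by positivity, fun X N m σ hX hXN hm hσ x y t hy ht => ?_⟩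
  have hN0 : 0 < N := by linarith
  have hmaj : 0 ≤ kernelMajorant N y := by
    have := nearProfile_nonneg (y / N)
    have := farProfile_nonneg (y / N ^ 2)
    unfold kernelMajorant
    positivity
  by_cases hI : Integrable (kernelIntegrand η f X (X * N) m σ x y t)
  · rw [Measure.volume_eq_prod, integral_prod _ hI]
    simp only [integral_kernelIntegrand_snd (f := f) (hηi 0 (by norm_num))
      (mul_pos (by linarith) hN0 : 0 < X * N)]
    rcases le_or_gt |y| (100 * N ^ 2) with h | h
    · refine (h₁ X N m σ hX hXN hm hσ x y t hy ht h).trans ?_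
      gcongr
      linarith
    · refine (h₂ X N m σ hX hXN hm hσ x y t ht h).trans ?_
      gcongr
      linarith
  · rw [integral_undef hI, norm_zero]
    positivity

end KernelBounds

lemma chiI_sub_one_add_one (μ₀ : ℝ → ℝ) (k : ℤ) (ξ : ℝ) :
    chiI μ₀ (k - 1) (k + 1) ξ = μ₀ (ξ / 2 ^ k / 2) - μ₀ (4 * (ξ / 2 ^ k)) := by
  have hIcc : Finset.Icc (k - 1) (k + 1) = {k - 1, k, k + 1} := by
    ext j
    simp only [Finset.mem_Icc, Finset.mem_insert, Finset.mem_singleton]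
    omega
  have h2 : (2 : ℝ) ≠ 0 := two_ne_zero
  have e1 : ξ / 2 ^ (k + 1) = ξ / 2 ^ k / 2 := by
    rw [zpow_add_one₀ h2, div_div]
  have e2 : ξ / 2 ^ (k - 1 - 1) = 4 * (ξ / 2 ^ k) := by
    rw [zpow_sub_one₀ h2, zpow_sub_one₀ h2]
    field_simp
    norm_num
  rw [chiI, hIcc, Finset.sum_insert (by simp; omega), Finset.sum_insert (by simp),
    Finset.sum_singleton, chi, chi, chi, add_sub_cancel_right, e1, e2]
  ring

theorem kernel_maximal_L1_bound_angular_high_freq (μ₀ : ℝ → ℝ)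
    (hsmooth : ContDiff ℝ (⊤ : ℕ∞) μ₀) (hrange : ∀ s, μ₀ s ∈ Icc (0:ℝ) 1)
    (hsupp : Function.support μ₀ ⊆ Icc (-8/5 : ℝ) (8/5))
    (hone : ∀ s ∈ Icc (-5/4 : ℝ) (5/4 : ℝ), μ₀ s = 1)
    (heven : ∀ s, μ₀ (-s) = μ₀ s) :
    ∃ C : ℝ, 0 < C ∧ ∀ k l : ℤ, 0 ≤ k → 2*k ≤ l →
      ∀ m σ : ℝ, |m| ≤ (2:ℝ) ^ (l - k + 3) → (σ = 1 ∨ σ = -1) →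
      ∫ y : ℝ,
        ⨆ (x : ℝ) (t : ℝ) (_ : |t| ≤ 1),
          ‖∫ q : ℝ × ℝ,
            (((chiI μ₀ (k - 1) (k + 1) q.1) ^ 2 *
                (μ₀ ((2:ℝ) ^ l * (q.2 / q.1 + σ * Real.sqrt 3 * q.1 - m))) ^ 2 : ℝ) : ℂ) *
              Complex.exp (Complex.I * ((x * q.1 + y * q.2 + t * disp q.1 q.2 : ℝ) : ℂ))‖ ≤
        C := by
  have hzero : ∀ s, 8 / 5 < |s| → μ₀ s = 0 := fun s hs => by
    by_contra h
    have := hsupp (Function.mem_support.2 h)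
    exact absurd (abs_le.2 ⟨by linarith [this.1], this.2⟩) (not_le.2 hs)
  set η : ℝ → ℝ := fun u => (μ₀ (u / 2) - μ₀ (4 * u)) ^ 2 with hη
  have hηc : ContDiff ℝ 1 η := by
    have : ContDiff ℝ 1 μ₀ := mod_cast contDiff_infty.1 hsmooth 1
    fun_prop
  have hfc : ContDiff ℝ 2 fun s => μ₀ s ^ 2 := by
    have : ContDiff ℝ 2 μ₀ := mod_cast contDiff_infty.1 hsmooth 2
    fun_prop
  obtain ⟨A, hA0, hA⟩ := exists_norm_integral_kernelIntegrand_le hηc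
    (fun u => by
      have h1 := hrange (u / 2)
      have h2 := hrange (4 * u)
      rw [abs_of_nonneg (sq_nonneg _), sq_le_one_iff_abs_le_one]
      exact abs_le.2 ⟨by linarith [h1.1, h2.2], by linarith [h1.2, h2.1]⟩)
    hfc
    (fun u hu => by
      have h1 : μ₀ (u / 2) = 0 := hzero _ (by
        rw [abs_div, abs_of_pos (by norm_num : (0 : ℝ) < 2)]
        linarith)
      have h2 : μ₀ (4 * u) = 0 := hzero _ (by
        rw [abs_mul, abs_of_pos (by norm_num : (0 : ℝ) < 4)]
        linarith)
      simp [hη, h1, h2])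
    (fun u hu => by
      have hu := abs_lt.1 hu
      have h1 : μ₀ (u / 2) = 1 := hone _ ⟨by linarith [hu.1], by linarith [hu.2]⟩
      have h2 : μ₀ (4 * u) = 1 := hone _ ⟨by linarith [hu.1], by linarith [hu.2]⟩
      simp [hη, h1, h2])
    (fun s hs => by simp [hzero s hs])
  have hI0 : 0 ≤ (∫ u, nearProfile u) + ∫ u, farProfile u :=
    add_nonneg (integral_nonneg nearProfile_nonneg) (integral_nonneg farProfile_nonneg)
  refine ⟨A * ((∫ u, nearProfile u) + ∫ u, farProfile u) + 1, by positivity,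
    fun k l hk hkl m σ hm hσ => ?_⟩
  have hX : (1 : ℝ) ≤ 2 ^ k := one_le_zpow₀ (by norm_num) hk
  have hXN : (2 : ℝ) ^ k ≤ 2 ^ (l - k) := zpow_le_zpow_right₀ (by norm_num) (by omega)
  have hN0 : (0 : ℝ) < 2 ^ (l - k) := by positivity
  have hL : (2 : ℝ) ^ l = 2 ^ k * 2 ^ (l - k) := by
    rw [← zpow_add₀ two_ne_zero]
    congr 1
    omega
  have hm' : |m| ≤ 8 * 2 ^ (l - k) := by
    rw [zpow_add₀ two_ne_zero] at hm
    norm_num at hm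
    linarith
  have hσ' : (σ * √3) ^ 2 = 3 := by
    rw [mul_pow, Real.sq_sqrt (by norm_num)]
    rcases hσ with rfl | rfl <;> norm_num
  have hmaj : ∀ y, 0 ≤ A * kernelMajorant (2 ^ (l - k)) y := fun y => by
    have := nearProfile_nonneg (y / 2 ^ (l - k))
    have := farProfile_nonneg (y / (2 ^ (l - k)) ^ 2)
    unfold kernelMajorant
    positivity
  calc _ ≤ ∫ y, A * kernelMajorant (2 ^ (l - k)) y := by
        refine integral_mono_of_nonneg (.of_forall fun y => ?_)
          ((integrable_kernelMajorant hN0).const_mul _) ?_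
        · exact Real.iSup_nonneg fun x => Real.iSup_nonneg fun t => Real.iSup_nonneg fun _ =>
            norm_nonneg _
        · filter_upwards [compl_mem_ae_iff.2 (measure_singleton (0 : ℝ))] with y hy
          refine Real.iSup_le (fun x => Real.iSup_le (fun t => Real.iSup_le (fun ht => ?_)
            (hmaj y)) (hmaj y)) (hmaj y)
          refine le_of_eq_of_le ?_ (hA _ _ m (σ * √3) hX hXN hm' hσ' x y t hy ht)
          simp only [kernelIntegrand, chiI_sub_one_add_one, hL, hη]
    _ = A * ((∫ u, nearProfile u) + ∫ u, farProfile u) := by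
        rw [integral_const_mul, integral_kernelMajorant hN0]
    _ ≤ _ := by linarith
end
end
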